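/- Let Γ be a group possessing a normal subgroup N isomorphic to ℤ × ℤ such that the quotient Γ/N is a free group. Then for every 2-cocycle μ : Γ × Γ → ℂˣ (for the trivial Γ-action) that is torsion modulo coboundaries, there exist an integer r ≥ 1, a function ρ : Γ → GL_r(ℂ), and a function c : Γ → ℂˣ such that ρ(g)·ρ(h) = (μ(g,h)·c(g)·c(h)·c(gh)⁻¹) • ρ(gh) for all g, h ∈ Γ; that is, up to a coboundary, μ is the obstruction cocycle of a projective representation of Γ. -/

import Mathlib

universe u v

/-- The underlying type of the central extension of `Γ` by `A` determined by a 2-cocycle `μ`. -/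
@[ext]
structure CocycleExtension {Γ : Type u} {A : Type v} (_μ : Γ → Γ → A) where
  /-- The component in the quotient. -/
  base : Γ
  /-- The component in the central kernel. -/
  fiber : A

namespace CocycleExtension

variable {Γ : Type u} {A : Type v} [Group Γ] [CommGroup A] {μ : Γ → Γ → A}

instance : Mul (CocycleExtension μ) :=
  ⟨fun x y => ⟨x.base * y.base, x.fiber * y.fiber * μ x.base y.base⟩⟩

instance : One (CocycleExtension μ) := ⟨⟨1, (μ 1 1)⁻¹⟩⟩

instance : Inv (CocycleExtension μ) :=
  ⟨fun x => ⟨x.base⁻¹, x.fiber⁻¹ * (μ x.base⁻¹ x.base)⁻¹ * (μ 1 1)⁻¹⟩⟩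

@[simp] theorem base_mul (x y : CocycleExtension μ) : (x * y).base = x.base * y.base := rfl

@[simp] theorem fiber_mul (x y : CocycleExtension μ) :
    (x * y).fiber = x.fiber * y.fiber * μ x.base y.base := rfl

@[simp] theorem base_one : (1 : CocycleExtension μ).base = 1 := rfl

@[simp] theorem fiber_one : (1 : CocycleExtension μ).fiber = (μ 1 1)⁻¹ := rfl

@[simp] theorem base_inv (x : CocycleExtension μ) : x⁻¹.base = x.base⁻¹ := rfl

@[simp] theorem fiber_inv (x : CocycleExtension μ) :
    x⁻¹.fiber = x.fiber⁻¹ * (μ x.base⁻¹ x.base)⁻¹ * (μ 1 1)⁻¹ := rfl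

theorem cocycle_one_left (hμ : ∀ g h k, μ h k * μ g (h * k) = μ g h * μ (g * h) k) (k : Γ) :
    μ 1 k = μ 1 1 := by
  have := hμ 1 1 k
  simp only [one_mul] at this
  exact mul_right_cancel this

theorem cocycle_one_right (hμ : ∀ g h k, μ h k * μ g (h * k) = μ g h * μ (g * h) k) (k : Γ) :
    μ k 1 = μ 1 1 := by
  have := hμ k 1 1
  simp only [mul_one] at this
  exact (mul_right_cancel this).symm

/-- The group structure on the extension determined by a 2-cocycle. -/
abbrev group (hμ : ∀ g h k, μ h k * μ g (h * k) = μ g h * μ (g * h) k) :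
    Group (CocycleExtension μ) :=
  Group.ofLeftAxioms
    (fun x y z => by
      ext
      · simp [mul_assoc]
      · simp only [fiber_mul, base_mul]
        have := hμ x.base y.base z.base
        calc _ = x.fiber * y.fiber * z.fiber *
              (μ x.base y.base * μ (x.base * y.base) z.base) := by ac_rfl
          _ = _ := by rw [← this]; ac_rfl)
    (fun x => by ext <;> simp [cocycle_one_left hμ, mul_comm])
    (fun x => by ext <;> simp [mul_comm, mul_assoc])

end CocycleExtension

open CocycleExtension in
/-- The central extension of `Γ` by `A` determined by a 2-cocycle, together with a set-theoretic
section `s` realizing the cocycle. -/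
theorem exists_centralExtension_of_cocycle {Γ : Type u} {A : Type v} [Group Γ] [CommGroup A]
    (μ : Γ → Γ → A) (hμ : ∀ g h k, μ h k * μ g (h * k) = μ g h * μ (g * h) k) :
    ∃ (E : Type (max u v)) (_ : Group E) (p : E →* Γ) (ι : A →* E) (s : Γ → E),
      Function.Injective ι ∧ ι.range = p.ker ∧ p.ker ≤ Subgroup.center E ∧
      Function.Surjective p ∧ ∀ g h, s g * s h = ι (μ g h) * s (g * h) := by
  let := CocycleExtension.group hμ
  let p : CocycleExtension μ →* Γ := MonoidHom.mk' CocycleExtension.base base_mul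
  let ι : A →* CocycleExtension μ := MonoidHom.mk' (fun a => ⟨1, a * (μ 1 1)⁻¹⟩) (fun a b => by
    ext
    · simp
    · simp [mul_comm, mul_left_comm, mul_assoc])
  have hker (x : CocycleExtension μ) : x ∈ p.ker ↔ x.base = 1 := Iff.rfl
  refine ⟨CocycleExtension μ, inferInstance, p, ι, fun g => ⟨g, 1⟩, ?_, ?_, ?_, ?_, ?_⟩
  · intro a b hab
    exact mul_right_cancel (congrArg CocycleExtension.fiber hab)
  · ext x
    rw [hker]
    constructor
    · rintro ⟨a, rfl⟩
      rfl
    · intro hx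
      refine ⟨x.fiber * μ 1 1, ?_⟩
      ext
      · exact hx.symm
      · exact mul_inv_cancel_right _ _
  · intro x hx
    rw [hker] at hx
    rw [Subgroup.mem_center_iff]
    intro y
    ext
    · simp [hx]
    · simp [hx, cocycle_one_left hμ, cocycle_one_right hμ y.base, mul_comm]
  · intro g
    exact ⟨⟨g, 1⟩, rfl⟩
  · intro g h
    ext
    · simp [ι]
    · simp [ι, cocycle_one_left hμ (g * h)]

/-- A character of a finite central subgroup that meets some finite-index subgroup trivially is
the central character of a finite-dimensional representation. -/
theorem exists_representation_of_centralCharacter {E : Type*} [Group E] (Z H : Subgroup E)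
    (hZ : Z ≤ Subgroup.center E) [H.FiniteIndex] (hd : Disjoint Z H) (χ : Z →* ℂˣ) :
    ∃ r : ℕ, 1 ≤ r ∧ ∃ π : E →* GL (Fin r) ℂ,
      ∀ z : Z, (π z : Matrix (Fin r) (Fin r) ℂ) = ((χ z : ℂˣ) : ℂ) • 1 := by
  classical
  have hcomm (z : Z) (g : E) : (z : E) * g = g * z :=
    (Subgroup.mem_center_iff.mp (hZ z.2) g).symm
  let V : Submodule ℂ (E ⧸ H → ℂ) :=
    { carrier := {f | ∀ (z : Z) (x : E ⧸ H), f ((z : E) • x) = ((χ z)⁻¹ : ℂˣ) * f x}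
      add_mem' := fun hf hg z x => by simp only [Pi.add_apply, hf z x, hg z x, mul_add]
      zero_mem' := fun z x => by simp
      smul_mem' := fun a f hf z x => by
        simp only [Pi.smul_apply, hf z x, smul_eq_mul, mul_left_comm] }
  have hmem (f : E ⧸ H → ℂ) : f ∈ V ↔
      ∀ (z : Z) (x : E ⧸ H), f ((z : E) • x) = ((χ z)⁻¹ : ℂˣ) * f x := Iff.rfl
  let τ : E →* (V →ₗ[ℂ] V) :=
    { toFun := fun g => (LinearMap.funLeft ℂ ℂ (fun x : E ⧸ H => g⁻¹ • x)).restrict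
        (p := V) (q := V) (fun f hf z x => by
          simp only [LinearMap.funLeft_apply]
          rw [smul_smul, ← hcomm, ← smul_smul, hf])
      map_one' := by
        ext f x
        simp [LinearMap.restrict_apply, LinearMap.funLeft_apply]
      map_mul' := fun g h => by
        ext f x
        simp [LinearMap.restrict_apply, LinearMap.funLeft_apply, smul_smul] }
  have hτ (g : E) (f : V) (x : E ⧸ H) : (τ g f : E ⧸ H → ℂ) x = (f : E ⧸ H → ℂ) (g⁻¹ • x) := rfl
  have hinj (z w : Z) (h : ((z : E) : E ⧸ H) = (w : E)) : z = w := by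
    have h' : ((z⁻¹ * w : Z) : E) ∈ H := by
      simpa using QuotientGroup.eq.mp h
    have := Subgroup.disjoint_def.mp hd (z⁻¹ * w).2 h'
    exact inv_mul_eq_one.mp (Subtype.ext this)
  have hV : Nontrivial V := by
    let f : E ⧸ H → ℂ := fun x =>
      if h : ∃ z : Z, ((z : E) : E ⧸ H) = x then (((χ h.choose)⁻¹ : ℂˣ) : ℂ) else 0
    have hf (z : Z) : f ((z : E) : E ⧸ H) = ((χ z)⁻¹ : ℂˣ) := by
      have h : ∃ w : Z, ((w : E) : E ⧸ H) = (z : E) := ⟨z, rfl⟩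
      simp only [f, dif_pos h, hinj _ _ h.choose_spec]
    have hfV : f ∈ V := by
      rw [hmem]
      intro z x
      by_cases h : ∃ w : Z, ((w : E) : E ⧸ H) = x
      · obtain ⟨w, rfl⟩ := h
        have := hf (z * w)
        rw [hf w]
        simpa [mul_comm] using this
      · have h' : ¬ ∃ w : Z, ((w : E) : E ⧸ H) = (z : E) • x := by
          rintro ⟨w, hw⟩
          refine h ⟨z⁻¹ * w, ?_⟩
          rw [eq_inv_smul_iff.mpr hw.symm]
          rfl
        simp only [f, dif_neg h, dif_neg h', mul_zero]
    refine ⟨⟨f, hfV⟩, 0, fun h0 => ?_⟩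
    have := congrFun (congrArg Subtype.val h0) ((1 : Z) : E)
    simp only [hf] at this
    exact Units.ne_zero _ this
  let b := Module.finBasis ℂ V
  refine ⟨Module.finrank ℂ V, Module.finrank_pos, (Units.map
    ((LinearMap.toMatrixAlgEquiv b : (V →ₗ[ℂ] V) ≃ₐ[ℂ] _) : (V →ₗ[ℂ] V) →* _)).comp
      τ.toHomUnits, fun z => ?_⟩
  have hz : τ z = ((χ z : ℂˣ) : ℂ) • 1 := by
    ext f x
    rw [hτ]
    have := (hmem _).mp f.2 z⁻¹ x
    simpa using this
  change LinearMap.toMatrixAlgEquiv b (τ z) = _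
  rw [hz, map_smul, map_one]

/-- A finite central extension of a (finitely generated torsion-free abelian)-by-free group has a
finite-index subgroup meeting the central kernel trivially. -/
theorem exists_finiteIndex_disjoint_ker {E Γ : Type*} [Group E] [Group Γ] (p : E →* Γ)
    (hp : Function.Surjective p) [Finite p.ker] (hc : p.ker ≤ Subgroup.center E)
    (N : Subgroup Γ) [N.Normal] (hcomm : ∀ a ∈ N, ∀ b ∈ N, a * b = b * a)
    (htf : ∀ a ∈ N, ∀ k : ℕ, 0 < k → a ^ k = 1 → a = 1) (hfg : N.FG)
    [IsFreeGroup (Γ ⧸ N)] :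
    ∃ H : Subgroup E, H.FiniteIndex ∧ Disjoint p.ker H := by
  obtain ⟨n, hn0, hn⟩ : ∃ n : ℕ, 0 < n ∧ ∀ z ∈ p.ker, z ^ n = 1 :=
    ⟨Nat.card p.ker, Nat.card_pos, fun z hz =>
      congrArg Subtype.val (pow_card_eq_one' (x := (⟨z, hz⟩ : p.ker)))⟩
  -- `C` is the center of the preimage of `N`
  let C : Subgroup E := N.comap p ⊓ Subgroup.centralizer (N.comap p : Subgroup E)
  have hC (x : E) : x ∈ C ↔ p x ∈ N ∧ ∀ y, p y ∈ N → y * x = x * y := by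
    simp [C, Subgroup.mem_inf, Subgroup.mem_centralizer_iff]
  have hCn : C.Normal := inferInstance
  have hpow (x : E) (hx : p x ∈ N) : x ^ n ∈ C := by
    refine (hC _).mpr ⟨by simpa using N.pow_mem hx n, fun y hy => ?_⟩
    set z := y * x * y⁻¹ * x⁻¹ with hz
    have hzk : z ∈ p.ker := by
      rw [MonoidHom.mem_ker, hz]
      simp [hcomm _ hy _ hx]
    have hzx : y * x * y⁻¹ = z * x := by simp [hz]
    have : Commute z x := (Subgroup.mem_center_iff.mp (hc hzk) x).symm
    rw [← mul_inv_eq_iff_eq_mul, ← conj_pow, hzx, this.mul_pow, hn z hzk, one_mul]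
  let K : Subgroup E :=
    { carrier := {x | ∃ y ∈ C, y ^ n = x}
      one_mem' := ⟨1, C.one_mem, one_pow n⟩
      mul_mem' := by
        rintro _ _ ⟨a, ha, rfl⟩ ⟨b, hb, rfl⟩
        have hab : Commute a b := ((hC b).mp hb).2 a ((hC a).mp ha).1
        exact ⟨a * b, C.mul_mem ha hb, hab.mul_pow n⟩
      inv_mem' := by
        rintro _ ⟨a, ha, rfl⟩
        exact ⟨a⁻¹, C.inv_mem ha, inv_pow a n⟩ }
  have hKn : K.Normal := ⟨by
    rintro _ ⟨a, ha, rfl⟩ g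
    exact ⟨g * a * g⁻¹, hCn.conj_mem a ha g, conj_pow⟩⟩
  have hKker (x : E) (hx : x ∈ K) (hxk : p x = 1) : x = 1 := by
    obtain ⟨y, hy, rfl⟩ := hx
    refine hn y (htf _ ((hC y).mp hy).1 n hn0 ?_)
    rwa [← map_pow]
  let q : E →* Γ ⧸ N := (QuotientGroup.mk' N).comp p
  have hq : Function.Surjective q := (QuotientGroup.mk'_surjective N).comp hp
  have hqN (x : E) : q x = 1 ↔ p x ∈ N := QuotientGroup.eq_one_iff (p x)
  obtain ⟨σ, hσ⟩ : ∃ σ : Γ ⧸ N →* E, ∀ f, q (σ f) = f := by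
    let σ : Γ ⧸ N →* E := IsFreeGroup.lift fun i => (hq (IsFreeGroup.of i)).choose
    have : q.comp σ = MonoidHom.id _ := IsFreeGroup.ext_hom fun i => by
      simpa [σ] using (hq (IsFreeGroup.of i)).choose_spec
    exact ⟨σ, DFunLike.congr_fun this⟩
  refine ⟨K ⊔ σ.range, ?_, ?_⟩
  · let : CommGroup N :=
      { (inferInstance : Group N) with
        mul_comm := fun a b => Subtype.ext (hcomm _ a.2 _ b.2) }
    let P : Subgroup N := (powMonoidHom (n * n) : N →* N).range
    have : Group.FG N := (Group.fg_iff_subgroup_fg N).mpr hfg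
    have : P.FiniteIndex :=
      Subgroup.finiteIndex_range_powMonoidHom_of_fg N (Nat.mul_pos hn0 hn0).ne'
    let F : p.ker × (N ⧸ P) → E ⧸ (K ⊔ σ.range) := fun t =>
      ((t.1 * (hp (t.2.out : N)).choose : E) : E ⧸ (K ⊔ σ.range))
    have hF : Function.Surjective F := by
      intro e
      obtain ⟨e, rfl⟩ := QuotientGroup.mk_surjective e
      set x := e * (σ (q e))⁻¹ with hx
      have hxN : p x ∈ N := by rw [← hqN]; simp [hx, hσ]
      set t : N ⧸ P := ((⟨p x, hxN⟩ : N) : N ⧸ P)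
      set l := (hp (t.out : N)).choose with hl
      have hpl : p l = (t.out : N) := (hp (t.out : N)).choose_spec
      obtain ⟨y, hy⟩ : (t.out)⁻¹ * ⟨p x, hxN⟩ ∈ P := QuotientGroup.eq.mp t.out_eq'
      obtain ⟨w, hw⟩ := hp (y : N)
      have hwN : p w ∈ N := hw ▸ y.2
      have hwK : w ^ (n * n) ∈ K := ⟨w ^ n, hpow w hwN, (pow_mul w n n).symm⟩
      have hy' : p w ^ (n * n) = (p l)⁻¹ * p x := by
        rw [hw, hpl]
        exact congrArg Subtype.val hy
      set z := x * (w ^ (n * n))⁻¹ * l⁻¹ with hz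
      have hzk : z ∈ p.ker := by
        rw [MonoidHom.mem_ker, hz]
        simp [hy']
      refine ⟨(⟨z, hzk⟩, t), ?_⟩
      change ((z * l : E) : E ⧸ (K ⊔ σ.range)) = e
      have he : (z * l)⁻¹ * e = w ^ (n * n) * σ (q e) := by
        simp [hz, hx, mul_assoc]
      rw [QuotientGroup.eq, he]
      exact Subgroup.mul_mem_sup hwK ⟨_, rfl⟩
    have := Finite.of_surjective F hF
    exact Subgroup.finiteIndex_of_finite_quotient
  · rw [Subgroup.disjoint_def]
    intro x hxk hx
    rw [← SetLike.mem_coe, Subgroup.normal_mul] at hx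
    obtain ⟨k, hk, _, ⟨f, rfl⟩, rfl⟩ := hx
    obtain ⟨y, hy, rfl⟩ := id hk
    have hqk : q (y ^ n) = 1 := by
      rw [hqN, map_pow]
      exact N.pow_mem ((hC y).mp hy).1 n
    have hf : f = 1 := by
      have h1 : q (y ^ n * σ f) = 1 := (hqN _).mpr (by
        rw [MonoidHom.mem_ker.mp hxk]
        exact N.one_mem)
      rwa [map_mul, hqk, one_mul, hσ] at h1
    subst hf
    simp only [map_one, mul_one] at hxk ⊢
    exact hKker _ hk hxk


/-- If `Γ` has a normal subgroup `N ≅ ℤ × ℤ` with free quotient `Γ/N`, then every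
`ℂˣ`-valued 2-cocycle on `Γ` (for the trivial action) that is torsion modulo
coboundaries is, up to a coboundary, the obstruction cocycle of a projective
representation of `Γ`. -/
theorem torsion_cocycle_from_projective_rep_of_ZxZ_by_free
    (Γ : Type) [Group Γ] (N : Subgroup Γ) [N.Normal]
    (hN : Nonempty (N ≃* Multiplicative (ℤ × ℤ)))
    (hfree : IsFreeGroup (Γ ⧸ N))
    (μ : Γ → Γ → ℂˣ)
    (hcocycle : ∀ g h k : Γ, μ h k * μ g (h * k) = μ g h * μ (g * h) k)
    (htorsion : ∃ n : ℕ, 0 < n ∧ ∃ c : Γ → ℂˣ,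
      ∀ g h : Γ, (μ g h) ^ n = c g * c h * (c (g * h))⁻¹) :
    ∃ (r : ℕ), 1 ≤ r ∧ ∃ (ρ : Γ → GL (Fin r) ℂ) (c : Γ → ℂˣ),
      ∀ g h : Γ, ((ρ g : Matrix (Fin r) (Fin r) ℂ) * (ρ h : Matrix (Fin r) (Fin r) ℂ)) =
        ((μ g h * c g * c h * (c (g * h))⁻¹ : ℂˣ) : ℂ) •
          (↑(ρ (g * h)) : Matrix (Fin r) (Fin r) ℂ) := by
  obtain ⟨e⟩ := hN
  obtain ⟨n, hn, c, hc⟩ := htorsion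
  have hroot (u : ℂˣ) : ∃ v : ℂˣ, v ^ n = u := by
    obtain ⟨v, hv⟩ := IsAlgClosed.exists_pow_nat_eq (u : ℂ) hn
    have hv0 : v ≠ 0 := by
      rintro rfl
      rw [zero_pow hn.ne'] at hv
      exact u.ne_zero hv.symm
    exact ⟨Units.mk0 v hv0, Units.ext (by simpa using hv)⟩
  choose d hd using fun g => hroot (c g)
  have : NeZero n := ⟨hn.ne'⟩
  let ν : Γ → Γ → rootsOfUnity n ℂ := fun g h =>
    ⟨μ g h * (d g)⁻¹ * (d h)⁻¹ * ((d (g * h))⁻¹)⁻¹, by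
      rw [mem_rootsOfUnity]
      simp only [mul_pow, inv_pow, hd, hc, inv_inv]
      exact Units.ext (by push_cast; field_simp)⟩
  have hν (g h k : Γ) : ν h k * ν g (h * k) = ν g h * ν (g * h) k := by
    apply Subtype.ext
    simp only [ν, Subgroup.coe_mul, inv_inv, mul_assoc g h k]
    have := hcocycle g h k
    calc _ = (μ h k * μ g (h * k)) * ((d g)⁻¹ * (d h)⁻¹ * (d k)⁻¹ * d (g * (h * k))) := by
          exact Units.ext (by push_cast; field_simp)
      _ = _ := by
          rw [this]
          exact Units.ext (by push_cast; field_simp)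
  obtain ⟨E, _, p, ι, s, hι, hrange, hcen, hp, hs⟩ := exists_centralExtension_of_cocycle ν hν
  have hfin : Finite p.ker := by
    rw [← hrange]
    exact Finite.of_surjective _ ι.rangeRestrict_surjective
  have hcomm (a : Γ) (ha : a ∈ N) (b : Γ) (hb : b ∈ N) : a * b = b * a := by
    have : (⟨a, ha⟩ : N) * ⟨b, hb⟩ = ⟨b, hb⟩ * ⟨a, ha⟩ :=
      e.injective (by rw [map_mul, map_mul, mul_comm])
    exact congrArg Subtype.val this
  have htf (a : Γ) (ha : a ∈ N) (k : ℕ) (hk : 0 < k) (h : a ^ k = 1) : a = 1 := by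
    have h1 : (⟨a, ha⟩ : N) ^ k = 1 := Subtype.ext h
    have h2 : e ⟨a, ha⟩ ^ k = 1 := by rw [← map_pow, h1, map_one]
    have h3 : k • (e ⟨a, ha⟩).toAdd = 0 := h2
    have h4 : e ⟨a, ha⟩ = 1 := (smul_eq_zero.mp h3).resolve_left hk.ne'
    exact congrArg Subtype.val ((map_eq_one_iff e e.injective).mp h4)
  have hfg : N.FG := by
    rw [← Group.fg_iff_subgroup_fg]
    have : AddGroup.FG (ℤ × ℤ) := inferInstance
    exact Group.fg_of_surjective (f := e.symm.toMonoidHom) e.symm.surjective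
  obtain ⟨H, _, hdisj⟩ := exists_finiteIndex_disjoint_ker p hp hcen N hcomm htf hfg
  let χ : p.ker →* ℂˣ := (rootsOfUnity n ℂ).subtype.comp
    ((MulEquiv.subgroupCongr hrange).symm.trans (MonoidHom.ofInjective hι).symm).toMonoidHom
  have hιker (a : rootsOfUnity n ℂ) : ι a ∈ p.ker := hrange ▸ ⟨a, rfl⟩
  have hχ (a : rootsOfUnity n ℂ) : χ ⟨ι a, hιker a⟩ = a := by
    have : (MonoidHom.ofInjective hι).symm ⟨ι a, ⟨a, rfl⟩⟩ = a := by
      rw [MulEquiv.symm_apply_eq]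
      rfl
    exact congrArg Subtype.val this
  obtain ⟨r, hr, π, hπ⟩ := exists_representation_of_centralCharacter p.ker H hcen hdisj χ
  refine ⟨r, hr, fun g => π (s g), fun g => (d g)⁻¹, fun g h => ?_⟩
  have h1 : π (s g) * π (s h) = π (ι (ν g h)) * π (s (g * h)) := by
    rw [← map_mul, hs, map_mul]
  have h2 := hπ ⟨ι (ν g h), hιker _⟩
  rw [hχ] at h2
  rw [← Units.val_mul, h1, Units.val_mul, h2, smul_mul_assoc, one_mul]
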